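/- Genus-0 tensor evaluated on two Euler fields and a dual-basis pair: Σ_α G₀(E, E, γ^α, γ_α) = −24 · ΔΦ, where Φ := −(1/24)Σ_α ⟨⟨E E γ_α γ^α⟩⟩₀ + (1/2)Σ_α (b_α(1−b_α) − (b₁+1)/6) ⟨⟨γ_α γ^α⟩⟩₀ and ΔΦ denotes the derivative of the function Φ along the vector field Δ. -/

import Mathlib

open scoped BigOperators

/-- Points of the small phase space `ℂ^N`. -/
abbrev Pt (N : ℕ) := Fin N → ℂ

/-- Vector fields on `ℂ^N` (components with respect to the basis `γ_α`). -/
abbrev VF (N : ℕ) := Pt N → Pt N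

/-- Partial derivative `∂/∂t^α`. -/
noncomputable def pd {N : ℕ} (α : Fin N) (F : Pt N → ℂ) : Pt N → ℂ :=
  fun t => fderiv ℂ F t (Pi.single α 1)

/-- The `k`-point function `⟨⟨v₁ ⋯ v_k⟩⟩` associated with a generating function `F`. -/
noncomputable def corr {N : ℕ} : (Pt N → ℂ) → List (VF N) → Pt N → ℂ
  | F, [] => F
  | F, v :: vs => fun t => ∑ α, v t α * corr (pd α F) vs t

/-- Constant vector field associated with an element of `ℂ^N`. -/
def cvf {N : ℕ} (x : Pt N) : VF N := fun _ => x

/-- The basis vector field `γ_α`. -/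
noncomputable def bas {N : ℕ} (α : Fin N) : VF N := cvf (Pi.single α 1)

/-- The dual basis vector field `γ^α = η^{αβ} γ_β`. -/
noncomputable def dua {N : ℕ} (ηinv : Matrix (Fin N) (Fin N) ℂ) (α : Fin N) : VF N :=
  cvf (fun β => ηinv α β)

/-- The quantum product `v ∘ w := ⟨⟨v w γ^α⟩⟩₀ γ_α` of two vector fields. -/
noncomputable def qp {N : ℕ} (F : Pt N → ℂ) (ηinv : Matrix (Fin N) (Fin N) ℂ)
    (v w : VF N) : VF N :=
  fun t σ => corr F [v, w, dua ηinv σ] t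

/-- The grading operator `G(Σ f_α γ_α) = Σ b_α f_α γ_α`. -/
def Gop {N : ℕ} (b : Fin N → ℂ) (v : VF N) : VF N := fun t α => b α * v t α

/-- The Euler vector field `E = c + Σ_α (b₁ + 1 - b_α) t^α γ_α`. -/
def euler {N : ℕ} (c : Pt N) (b : Fin N → ℂ) (b1 : ℂ) : VF N :=
  fun t α => c α + (b1 + 1 - b α) * t α

/-- The quantum volume element `Δ := γ^α ∘ γ_α`. -/
noncomputable def qvol {N : ℕ} (F : Pt N → ℂ) (ηinv : Matrix (Fin N) (Fin N) ℂ) : VF N :=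
  fun t => ∑ α, qp F ηinv (dua ηinv α) (bas α) t

/-- Covariant derivative `∇_v w` with respect to the trivial connection (`∇ γ_α = 0`). -/
noncomputable def nablaVF {N : ℕ} (v w : VF N) : VF N :=
  fun t α => fderiv ℂ (fun s => w s α) t (v t)

/-- Derivative of a function along a vector field. -/
noncomputable def dirD {N : ℕ} (v : VF N) (f : Pt N → ℂ) : Pt N → ℂ :=
  fun t => fderiv ℂ f t (v t)

/-- Quantum powers of a vector field: `E⁰ := γ₁`, `E^{k+1} := E ∘ E^k`. -/
noncomputable def epow {N : ℕ} [NeZero N] (F : Pt N → ℂ) (ηinv : Matrix (Fin N) (Fin N) ℂ)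
    (E : VF N) : ℕ → VF N
  | 0 => bas 0
  | k + 1 => qp F ηinv E (epow F ηinv E k)

/-- The genus-0 part `G₀` of Getzler's equation. -/
noncomputable def G0func {N : ℕ} (F0 : Pt N → ℂ) (ηinv : Matrix (Fin N) (Fin N) ℂ)
    (v : Fin 4 → VF N) (t : Pt N) : ℂ :=
  ∑ g : Equiv.Perm (Fin 4),
    ((1/6) * ∑ α, corr F0 [v (g 0), v (g 1), v (g 2), dua ηinv α] t *
        (∑ β, corr F0 [bas α, v (g 3), bas β, dua ηinv β] t)
    + (1/24) * ∑ α, corr F0 [v (g 0), v (g 1), v (g 2), v (g 3), dua ηinv α] t *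
        (∑ β, corr F0 [bas α, bas β, dua ηinv β] t)
    - (1/4) * ∑ α, ∑ β, corr F0 [v (g 0), v (g 1), dua ηinv α, dua ηinv β] t *
        corr F0 [bas α, bas β, v (g 2), v (g 3)] t)

/-- The genus-1 part `G₁` of Getzler's equation. -/
noncomputable def G1func {N : ℕ} (F0 F1 : Pt N → ℂ) (ηinv : Matrix (Fin N) (Fin N) ℂ)
    (v : Fin 4 → VF N) (t : Pt N) : ℂ :=
  ∑ g : Equiv.Perm (Fin 4),
    (3 * corr F1 [qp F0 ηinv (v (g 0)) (v (g 1)), qp F0 ηinv (v (g 2)) (v (g 3))] t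
    - 4 * corr F1 [qp F0 ηinv (qp F0 ηinv (v (g 0)) (v (g 1))) (v (g 2)), v (g 3)] t
    - ∑ α, corr F0 [qp F0 ηinv (v (g 0)) (v (g 1)), v (g 2), v (g 3), dua ηinv α] t *
        corr F1 [bas α] t
    + 2 * ∑ α, corr F0 [v (g 0), v (g 1), v (g 2), dua ηinv α] t *
        corr F1 [qp F0 ηinv (bas α) (v (g 3))] t)

open Finset

section Smooth

variable {N : ℕ}

/-- Partial derivatives of smooth functions are smooth. -/
theorem contDiff_pd {F : Pt N → ℂ} (hF : ContDiff ℂ (⊤ : ℕ∞) F) (α : Fin N) :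
    ContDiff ℂ (⊤ : ℕ∞) (pd α F) :=
  (hF.fderiv_right (m := (⊤ : ℕ∞)) (by simp)).clm_apply contDiff_const

theorem pd_comm {F : Pt N → ℂ} (hF : ContDiff ℂ (⊤ : ℕ∞) F) (α β : Fin N) :
    pd α (pd β F) = pd β (pd α F) := by
  have hd : Differentiable ℂ (fderiv ℂ F) :=
    (hF.fderiv_right (m := (⊤ : ℕ∞)) (by simp)).differentiable (by simp)
  have key : ∀ α β : Fin N, ∀ t, pd α (pd β F) t
      = fderiv ℂ (fderiv ℂ F) t (Pi.single α 1) (Pi.single β 1) := by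
    intro α β t
    change fderiv ℂ (fun s => fderiv ℂ F s (Pi.single β 1)) t (Pi.single α 1) = _
    rw [fderiv_clm_apply (hd t) (differentiableAt_const _)]
    simp
  funext t
  rw [key, key]
  exact (hF.contDiffAt.isSymmSndFDerivAt (by
    simpa using WithTop.coe_le_coe.2 (le_top : (2 : ℕ∞) ≤ ⊤))) _ _

theorem fderiv_eq_sum_pd (F : Pt N → ℂ) (t x : Pt N) :
    fderiv ℂ F t x = ∑ α, x α * pd α F t := by
  conv_lhs => rw [← Finset.univ_sum_single x]
  rw [map_sum]
  refine Finset.sum_congr rfl fun α _ => ?_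
  have : (Pi.single α (x α) : Pt N) = x α • Pi.single α 1 := by
    rw [← Pi.single_smul, smul_eq_mul, mul_one]
  rw [this, map_smul, smul_eq_mul, pd]

theorem corr_nil (F : Pt N → ℂ) (t : Pt N) : corr F [] t = F t := rfl

theorem corr_cons (F : Pt N → ℂ) (v : VF N) (l : List (VF N)) (t : Pt N) :
    corr F (v :: l) t = ∑ α, v t α * corr (pd α F) l t := rfl

theorem corr_bas_cons (F : Pt N → ℂ) (α : Fin N) (l : List (VF N)) (t : Pt N) :
    corr F (bas α :: l) t = corr (pd α F) l t := by
  rw [corr_cons, Finset.sum_eq_single α] <;> simp +contextual [bas, cvf]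

theorem corr_dua_cons (F : Pt N → ℂ) (ηinv : Matrix (Fin N) (Fin N) ℂ) (α : Fin N)
    (l : List (VF N)) (t : Pt N) :
    corr F (dua ηinv α :: l) t = ∑ β, ηinv α β * corr F (bas β :: l) t := by
  simp only [corr_bas_cons]; rfl

/-- Correlators are symmetric in their arguments. -/
theorem corr_perm {l l' : List (VF N)} (h : l.Perm l') :
    ∀ {F : Pt N → ℂ}, ContDiff ℂ (⊤ : ℕ∞) F → ∀ t, corr F l t = corr F l' t := by
  induction h with
  | nil => intros; rfl
  | cons v _ ih =>
    intro F hF t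
    simp only [corr_cons]
    exact Finset.sum_congr rfl fun α _ => by rw [ih (contDiff_pd hF α)]
  | swap v w l =>
    intro F hF t
    simp only [corr_cons, Finset.mul_sum]
    rw [Finset.sum_comm]
    refine Finset.sum_congr rfl fun α _ => Finset.sum_congr rfl fun β _ => ?_
    rw [pd_comm hF]; ring
  | trans _ _ ih₁ ih₂ => intro F hF t; rw [ih₁ hF, ih₂ hF]

theorem corr_differentiable {l : List (VF N)} (hl : ∀ v ∈ l, Differentiable ℂ v) :
    ∀ {F : Pt N → ℂ}, ContDiff ℂ (⊤ : ℕ∞) F → Differentiable ℂ (corr F l) := by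
  induction l with
  | nil => intro F hF; exact hF.differentiable (by simp)
  | cons v l ih =>
    intro F hF
    have hv := hl v (by simp)
    have h := fun α => ih (fun w hw => hl w (by simp [hw])) (contDiff_pd hF α)
    change Differentiable ℂ (fun t => ∑ α, v t α * corr (pd α F) l t)
    exact Differentiable.fun_sum fun α _ => (differentiable_pi.1 hv α).mul (h α)

theorem dirD_corr_cons {F : Pt N → ℂ} (hF : ContDiff ℂ (⊤ : ℕ∞) F) (x v : VF N)
    (hv : Differentiable ℂ v) {l : List (VF N)} (hl : ∀ w ∈ l, Differentiable ℂ w) (t : Pt N) :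
    dirD x (corr F (v :: l)) t
      = corr F (nablaVF x v :: l) t + ∑ α, v t α * dirD x (corr (pd α F) l) t := by
  have hva := fun α => differentiable_pi.1 hv α
  have h := fun α => corr_differentiable hl (contDiff_pd hF α)
  change fderiv ℂ (fun t => ∑ α, v t α * corr (pd α F) l t) t (x t) = _
  rw [fderiv_fun_sum fun α _ => ((hva α).fun_mul (h α)) t, corr_cons, ← Finset.sum_add_distrib,
    _root_.sum_apply]
  refine Finset.sum_congr rfl fun α _ => ?_
  rw [fderiv_fun_mul (hva α t) (h α t)]
  simp only [nablaVF, dirD, add_apply, smul_apply,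
    smul_eq_mul]
  ring

theorem nablaVF_cvf (x : VF N) (y : Pt N) : nablaVF x (cvf y) = cvf 0 := by
  funext t α
  simp [nablaVF, cvf]

theorem dirD_corr_cvf (x : VF N) (t : Pt N) (l : List (Pt N)) :
    ∀ {F : Pt N → ℂ}, ContDiff ℂ (⊤ : ℕ∞) F →
      dirD x (corr F (l.map cvf)) t = corr F (x :: l.map cvf) t := by
  induction l with
  | nil => intro F _; exact fderiv_eq_sum_pd F t (x t)
  | cons y l ih =>
    intro F hF
    rw [List.map_cons, dirD_corr_cons hF x (cvf y) (differentiable_const _)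
      (by simp only [List.mem_map]; rintro _ ⟨z, -, rfl⟩; exact differentiable_const _),
      nablaVF_cvf, corr_perm (List.Perm.swap (cvf y) x _) hF]
    simp only [corr_cons _ (cvf y), corr_cons _ (cvf 0), ih (contDiff_pd hF _)]
    simp [cvf]

end Smooth

section Euler

variable {N : ℕ}

theorem differentiable_euler (c : Pt N) (b : Fin N → ℂ) (b1 : ℂ) :
    Differentiable ℂ (euler c b b1) :=
  differentiable_pi.2 fun α => by unfold euler; fun_prop

theorem nablaVF_euler (x : VF N) (c : Pt N) (b : Fin N → ℂ) (b1 : ℂ) (t : Pt N) (α : Fin N) :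
    nablaVF x (euler c b b1) t α = (b1 + 1 - b α) * x t α := by
  simp only [nablaVF, euler]
  rw [fderiv_const_add, fderiv_const_mul (by fun_prop)]
  have : fderiv ℂ (fun s : Pt N => s α) t = ContinuousLinearMap.proj α :=
    (ContinuousLinearMap.proj (R := ℂ) (φ := fun _ : Fin N => ℂ) α).fderiv
  rw [this]; simp

/-- Quasi-homogeneity passes to partial derivatives. -/
theorem corr_euler_pd {F q : Pt N → ℂ} (hF : ContDiff ℂ (⊤ : ℕ∞) F) (hq : Differentiable ℂ q)
    {c : Pt N} {b : Fin N → ℂ} {b1 w : ℂ}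
    (h : ∀ t, corr F [euler c b b1] t = w * F t + q t) (β : Fin N) (t : Pt N) :
    corr (pd β F) [euler c b b1] t = (w - (b1 + 1 - b β)) * pd β F t + pd β q t := by
  have h1 := dirD_corr_cons hF (bas β) _ (differentiable_euler c b b1) (l := []) (by simp) t
  have h2 : corr F [euler c b b1] = fun t => w * F t + q t := funext h
  have h3 : dirD (bas β) (fun t => w * F t + q t) t = w * pd β F t + pd β q t := by
    have hd : Differentiable ℂ F := hF.differentiable (by simp)
    simp only [dirD, pd, bas, cvf]
    rw [fderiv_fun_add ((hd t).const_mul w) (hq t), fderiv_const_mul (hd t)]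
    simp
  have h4 : corr F [nablaVF (bas β) (euler c b b1)] t = (b1 + 1 - b β) * pd β F t := by
    simp only [corr, nablaVF_euler]
    rw [Finset.sum_eq_single β] <;> simp +contextual [bas, cvf]
  have h5 : ∑ α, euler c b b1 t α * dirD (bas β) (corr (pd α F) []) t
      = corr (pd β F) [euler c b b1] t := by
    rw [corr_cons]
    refine Finset.sum_congr rfl fun α _ => ?_
    rw [show corr (pd α F) [] = pd α F from rfl]
    change _ * pd β (pd α F) t = _ * pd α (pd β F) t
    rw [pd_comm hF]
  rw [h2, h3, h4, h5] at h1
  linear_combination -h1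

theorem pd_pd_pd_quadratic (C : Matrix (Fin N) (Fin N) ℂ) (α β γ : Fin N) (t : Pt N) :
    pd α (pd β (pd γ fun t => (1/2) * ∑ i, ∑ j, C i j * t i * t j)) t = 0 := by
  have hc : ∀ (i : Fin N) (t : Pt N), HasFDerivAt (fun s : Pt N => s i)
      (ContinuousLinearMap.proj (R := ℂ) (φ := fun _ : Fin N => ℂ) i) t := fun i t =>
    (ContinuousLinearMap.proj (R := ℂ) (φ := fun _ : Fin N => ℂ) i).hasFDerivAt
  have h1 : ∀ γ : Fin N, pd γ (fun t => (1/2) * ∑ i, ∑ j, C i j * t i * t j)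
      = fun t => (1/2) * ∑ i, ∑ j, C i j * ((Pi.single γ (1 : ℂ) : Pt N) i * t j
          + t i * (Pi.single γ (1 : ℂ) : Pt N) j) := by
    intro γ; funext t
    have := (HasFDerivAt.fun_sum (u := univ) fun i _ => HasFDerivAt.fun_sum (u := univ) fun j _ =>
      (((hc i t).const_mul (C i j)).mul (hc j t))).const_mul (1/2 : ℂ)
    refine (DFunLike.congr_fun this.fderiv _).trans ?_
    simp only [smul_apply, _root_.sum_apply,
      add_apply, ContinuousLinearMap.proj_apply, smul_eq_mul]
    congr 1
    refine Finset.sum_congr rfl fun i _ => Finset.sum_congr rfl fun j _ => ?_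
    ring
  have h2 : ∀ β γ : Fin N, ∃ k : ℂ, pd β (pd γ fun t => (1/2) * ∑ i, ∑ j, C i j * t i * t j)
      = fun _ => k := by
    intro β γ
    rw [h1]
    have := fun t => (HasFDerivAt.fun_sum (u := univ) fun i _ =>
      HasFDerivAt.fun_sum (u := univ) fun j _ =>
      (((hc j t).const_mul ((Pi.single γ (1 : ℂ) : Pt N) i)).add
        ((hc i t).mul_const ((Pi.single γ (1 : ℂ) : Pt N) j))).const_mul (C i j)).const_mul (1/2 : ℂ)
    exact ⟨_, funext fun t => DFunLike.congr_fun (this t).fderiv _⟩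
  obtain ⟨k, hk⟩ := h2 β γ
  rw [hk]; simp [pd]

/-- The vector `x` is homogeneous of weight `w` for the grading `b`. -/
def IsWeight (b : Fin N → ℂ) (x : Pt N) (w : ℂ) : Prop := ∀ α, x α ≠ 0 → b α = w

theorem isWeight_single (b : Fin N → ℂ) (α : Fin N) : IsWeight b (Pi.single α 1) (b α) := by
  intro β h
  by_cases e : β = α
  · rw [e]
  · simp [e] at h

/-- The four-point function with an Euler field in terms of the three-point function. -/
theorem corr_euler_cvf {F : Pt N → ℂ} (hF : ContDiff ℂ (⊤ : ℕ∞) F)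
    {c : Pt N} {b : Fin N → ℂ} {b1 : ℂ} {C : Matrix (Fin N) (Fin N) ℂ}
    (hqh : ∀ t, fderiv ℂ F t (euler c b b1 t)
      = 2 * (b1 + 1) * F t + (1/2) * ∑ α, ∑ β, C α β * t α * t β)
    {x y z : Pt N} {p q r : ℂ} (hx : IsWeight b x p) (hy : IsWeight b y q) (hz : IsWeight b z r)
    (t : Pt N) :
    corr F [euler c b b1, cvf x, cvf y, cvf z] t
      = (p + q + r - (b1 + 1)) * corr F [cvf x, cvf y, cvf z] t := by
  set Q : Pt N → ℂ := fun t => (1/2) * ∑ i, ∑ j, C i j * t i * t j with hQ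
  have hQs : ContDiff ℂ (⊤ : ℕ∞) Q := by rw [hQ]; fun_prop
  have h0 : ∀ t, corr F [euler c b b1] t = (2 * (b1 + 1)) * F t + Q t := fun t => by
    rw [← hqh t, fderiv_eq_sum_pd]; rfl
  have h1 := fun α => corr_euler_pd hF (hQs.differentiable (by simp)) h0 α
  have h2 := fun α β => corr_euler_pd (contDiff_pd hF α)
    ((contDiff_pd hQs α).differentiable (by simp)) (h1 α) β
  have h3 := fun α β γ => corr_euler_pd (contDiff_pd (contDiff_pd hF α) β)
    ((contDiff_pd (contDiff_pd hQs α) β).differentiable (by simp)) (h2 α β) γ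
  have hp : ([euler c b b1, cvf x, cvf y, cvf z] : List (VF N)).Perm
      [cvf x, cvf y, cvf z, euler c b b1] :=
    (List.perm_append_comm (l₁ := [euler c b b1]) (l₂ := [cvf x, cvf y, cvf z]))
  rw [corr_perm hp hF]
  simp only [corr_cons _ (cvf _), h3, Finset.mul_sum]
  refine Finset.sum_congr rfl fun α _ => Finset.sum_congr rfl fun β _ =>
    Finset.sum_congr rfl fun γ _ => ?_
  rw [show pd γ (pd β (pd α Q)) t = 0 from pd_pd_pd_quadratic C γ β α t]
  simp only [cvf, corr]
  rcases eq_or_ne (x α) 0 with h | h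
  · simp [h]
  rcases eq_or_ne (y β) 0 with h' | h'
  · simp [h']
  rcases eq_or_ne (z γ) 0 with h'' | h''
  · simp [h'']
  rw [hx α h, hy β h', hz γ h'']
  ring

end Euler

section Tensor

variable {N : ℕ} {h : Matrix (Fin N) (Fin N) ℂ} {b : Fin N → ℂ}

/-- Since `b α + b β = 1` on the support of `h`, weighting a symmetric contraction by `b` halves
it. -/
theorem sum_weight_contraction (hs : ∀ α β, h α β = h β α)
    (hb : ∀ α β, h α β ≠ 0 → b α + b β = 1) (X : Fin N → Fin N → ℂ) (hX : ∀ α β, X α β = X β α) :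
    ∑ α, ∑ β, b α * (h α β * X α β) = (1/2) * ∑ α, ∑ β, h α β * X α β := by
  have h1 : ∑ α, ∑ β, b α * (h α β * X α β) = ∑ α, ∑ β, b β * (h α β * X α β) := by
    rw [Finset.sum_comm]
    exact Finset.sum_congr rfl fun α _ => Finset.sum_congr rfl fun β _ => by rw [hs, hX]
  have h2 : ∑ α, ∑ β, b α * (h α β * X α β) + ∑ α, ∑ β, b β * (h α β * X α β)
      = ∑ α, ∑ β, h α β * X α β := by
    simp only [← Finset.sum_add_distrib]
    refine Finset.sum_congr rfl fun α _ => Finset.sum_congr rfl fun β _ => ?_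
    rcases eq_or_ne (h α β) 0 with e | e
    · simp [e]
    · linear_combination h α β * X α β * hb α β e
  linear_combination (1/2) * h1 + (1/2) * h2

/-- The contraction identity for a symmetric three-tensor satisfying the associativity equation,
graded by weights that are dual with respect to the metric. -/
theorem weighted_contraction_identity (hs : ∀ α β, h α β = h β α)
    (hb : ∀ α β, h α β ≠ 0 → b α + b β = 1) (k : ℂ) (T : Fin N → Fin N → Fin N → ℂ)
    (h12 : ∀ α β γ, T α β γ = T β α γ) (h23 : ∀ α β γ, T α β γ = T α γ β)
    (hT : ∀ x y z w, ∑ σ, ∑ ρ, h σ ρ * (T x y σ * T z w ρ)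
      = ∑ σ, ∑ ρ, h σ ρ * (T x z σ * T y w ρ))
    (K : Fin N → Fin N → ℂ) (hK : ∀ α γ, K α γ = ∑ β, h α β * T α β γ)
    (D U : Fin N → ℂ) (hD : ∀ γ, D γ = ∑ α, K α γ) (hU : ∀ α, U α = ∑ β, h α β * D β)
    (P : Fin N → Fin N → Fin N → ℂ)
    (hP : ∀ α β γ, P α β γ = ∑ α', ∑ β', ∑ γ', h α α' * h β β' * h γ γ' * T α' β' γ') :
    2 * ∑ α, (2 - b α - k) * (b α + 1 - k) * (U α * D α)
      - 4 * ∑ α, ∑ β, ∑ γ, (b α + b β + b γ - k) * (3 - b α - b β - b γ - k)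
          * (T α β γ * P α β γ)
    = 2 * ∑ α, (k - b α) * (b α + 1 - k) * (U α * D α)
      - 12 * ∑ α, (b α * (1 - b α) - k / 6) * ∑ σ, U σ * K α σ := by
  have hbK : ∀ γ, ∑ α, b α * K α γ = (1/2) * D γ := fun γ => by
    have := sum_weight_contraction hs hb (fun α β => T α β γ) fun α β => h12 α β γ
    simpa only [hK, hD, Finset.mul_sum] using this
  have hbD : ∑ α, b α * (U α * D α) = (1/2) * ∑ α, U α * D α := by
    have := sum_weight_contraction hs hb (fun α β => D β * D α) fun α β => mul_comm _ _
    simpa only [hU, Finset.mul_sum, Finset.sum_mul, mul_assoc] using this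
  have hP12 : ∀ α β γ, P α β γ = P β α γ := fun α β γ => by
    rw [hP, hP, Finset.sum_comm]
    exact Finset.sum_congr rfl fun _ _ => Finset.sum_congr rfl fun _ _ =>
      Finset.sum_congr rfl fun _ _ => by rw [h12]; ring
  have hP23 : ∀ α β γ, P α β γ = P α γ β := fun α β γ => by
    rw [hP, hP]
    refine Finset.sum_congr rfl fun _ _ => ?_
    rw [Finset.sum_comm]
    exact Finset.sum_congr rfl fun _ _ => Finset.sum_congr rfl fun _ _ => by rw [h23]; ring
  set Z : Fin N → Fin N → Fin N → ℂ := fun α β γ => T α β γ * P α β γ with hZ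
  have hZ12 : ∀ α β γ, Z α β γ = Z β α γ := fun α β γ => by simp only [hZ]; rw [h12, hP12]
  have hZ23 : ∀ α β γ, Z α β γ = Z α γ β := fun α β γ => by simp only [hZ]; rw [h23, hP23]
  have hW : ∀ α β, ∑ γ, Z α β γ = ∑ σ, ∑ ρ, h σ ρ * (K α σ * K β ρ) := fun α β => by
    calc ∑ γ, Z α β γ
        = ∑ α', ∑ β', h α α' * h β β' * ∑ γ, ∑ γ', h γ γ' * (T α β γ * T α' β' γ') := by
          simp only [hZ, hP, Finset.mul_sum]
          rw [Finset.sum_comm]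
          refine Finset.sum_congr rfl fun _ _ => ?_
          rw [Finset.sum_comm]
          exact Finset.sum_congr rfl fun _ _ => Finset.sum_congr rfl fun _ _ =>
            Finset.sum_congr rfl fun _ _ => by ring
      _ = ∑ α', ∑ β', ∑ σ, ∑ ρ, h σ ρ * (h α α' * T α α' σ * (h β β' * T β β' ρ)) := by
          refine Finset.sum_congr rfl fun α' _ => Finset.sum_congr rfl fun β' _ => ?_
          rw [hT]
          simp only [Finset.mul_sum]
          exact Finset.sum_congr rfl fun _ _ => Finset.sum_congr rfl fun _ _ => by ring
      _ = ∑ σ, ∑ ρ, ∑ α', ∑ β', h σ ρ * (h α α' * T α α' σ * (h β β' * T β β' ρ)) := by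
          rw [Finset.sum_congr rfl fun α' _ => Finset.sum_comm, Finset.sum_comm]
          refine Finset.sum_congr rfl fun σ _ => ?_
          rw [Finset.sum_congr rfl fun α' _ => Finset.sum_comm, Finset.sum_comm]
      _ = _ := by
          refine Finset.sum_congr rfl fun σ _ => Finset.sum_congr rfl fun ρ _ => ?_
          rw [hK, hK, Finset.sum_mul_sum]
          simp only [Finset.mul_sum]
  have hWb : ∀ φ : Fin N → Fin N → ℂ, ∑ α, ∑ β, ∑ γ, φ α β * Z α β γ
      = ∑ σ, ∑ ρ, h σ ρ * ∑ α, ∑ β, φ α β * (K α σ * K β ρ) := fun φ => by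
    simp only [← Finset.mul_sum, hW]
    simp only [Finset.mul_sum]
    calc _ = ∑ α, ∑ σ, ∑ β, ∑ ρ, φ α β * (h σ ρ * (K α σ * K β ρ)) :=
          Finset.sum_congr rfl fun α _ => Finset.sum_comm
      _ = ∑ σ, ∑ α, ∑ ρ, ∑ β, φ α β * (h σ ρ * (K α σ * K β ρ)) := by
          rw [Finset.sum_comm]
          exact Finset.sum_congr rfl fun _ _ => Finset.sum_congr rfl fun _ _ => Finset.sum_comm
      _ = _ := by
          refine Finset.sum_congr rfl fun _ _ => ?_
          rw [Finset.sum_comm]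
          exact Finset.sum_congr rfl fun _ _ => Finset.sum_congr rfl fun _ _ =>
            Finset.sum_congr rfl fun _ _ => by ring
  have hUD : ∑ σ, ∑ ρ, h σ ρ * (D σ * D ρ) = ∑ α, U α * D α := by
    simp only [hU, Finset.sum_mul]
    exact Finset.sum_congr rfl fun _ _ => Finset.sum_congr rfl fun _ _ => by ring
  have hbb : ∑ α, ∑ β, ∑ γ, b α * b β * Z α β γ = (1/4) * ∑ α, U α * D α := by
    rw [hWb fun α β => b α * b β, ← hUD, Finset.mul_sum]
    refine Finset.sum_congr rfl fun σ _ => ?_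
    rw [Finset.mul_sum]
    refine Finset.sum_congr rfl fun ρ _ => ?_
    have : ∑ α, ∑ β, b α * b β * (K α σ * K β ρ) = (∑ α, b α * K α σ) * ∑ β, b β * K β ρ := by
      rw [Finset.sum_mul_sum]
      exact Finset.sum_congr rfl fun _ _ => Finset.sum_congr rfl fun _ _ => by ring
    rw [this, hbK, hbK]; ring
  have h1 : ∀ φ : Fin N → ℂ, ∑ α, ∑ β, ∑ γ, φ α * Z α β γ = ∑ α, φ α * ∑ σ, U σ * K α σ :=
    fun φ => by
    simp only [← Finset.mul_sum, hW]
    refine Finset.sum_congr rfl fun α _ => congrArg (φ α * ·) ?_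
    simp only [hU, hD, Finset.sum_mul, Finset.mul_sum]
    rw [Finset.sum_comm]
    refine Finset.sum_congr rfl fun σ _ => ?_
    rw [Finset.sum_comm]
    exact Finset.sum_congr rfl fun _ _ => Finset.sum_congr rfl fun _ _ => by ring
  have h2 : ∀ φ : Fin N → ℂ, ∑ α, ∑ β, ∑ γ, φ β * Z α β γ = ∑ α, φ α * ∑ σ, U σ * K α σ :=
    fun φ => by
    rw [← h1, Finset.sum_comm]
    simp only [hZ12]
  have h3 : ∀ φ : Fin N → ℂ, ∑ α, ∑ β, ∑ γ, φ γ * Z α β γ = ∑ α, φ α * ∑ σ, U σ * K α σ :=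
    fun φ => by
    rw [← h2, Finset.sum_congr rfl fun α _ => Finset.sum_comm]
    simp only [hZ23]
  have hbb' : ∑ α, ∑ β, ∑ γ, b α * b γ * Z α β γ = (1/4) * ∑ α, U α * D α := by
    rw [← hbb, Finset.sum_congr rfl fun α _ => Finset.sum_comm]
    simp only [hZ23]
  have hbb'' : ∑ α, ∑ β, ∑ γ, b β * b γ * Z α β γ = (1/4) * ∑ α, U α * D α := by
    rw [← hbb', Finset.sum_comm]
    simp only [hZ12]
  have hbX : ∑ α, b α * ∑ σ, U σ * K α σ = (1/2) * ∑ α, U α * D α := by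
    simp only [Finset.mul_sum]
    rw [Finset.sum_comm]
    refine Finset.sum_congr rfl fun σ _ => ?_
    have := congrArg (U σ * ·) (hbK σ)
    simp only [Finset.mul_sum] at this
    calc _ = ∑ α, U σ * (b α * K α σ) := Finset.sum_congr rfl fun _ _ => by ring
      _ = _ := by rw [this]; ring
  have hX : ∑ α, ∑ σ, U σ * K α σ = ∑ α, U α * D α := by
    rw [Finset.sum_comm]
    simp only [hD, Finset.mul_sum]
  have e1 : ∑ α, ∑ β, ∑ γ, (b α + b β + b γ - k) * (3 - b α - b β - b γ - k) * Z α β γ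
      = ∑ α, ∑ β, ∑ γ, (3 * b α - b α ^ 2 + k ^ 2 - 3 * k) * Z α β γ
        + ∑ α, ∑ β, ∑ γ, (3 * b β - b β ^ 2) * Z α β γ
        + ∑ α, ∑ β, ∑ γ, (3 * b γ - b γ ^ 2) * Z α β γ
        - 2 * (∑ α, ∑ β, ∑ γ, b α * b β * Z α β γ + ∑ α, ∑ β, ∑ γ, b α * b γ * Z α β γ
          + ∑ α, ∑ β, ∑ γ, b β * b γ * Z α β γ) := by
    simp only [← Finset.sum_add_distrib, Finset.mul_sum, ← Finset.sum_sub_distrib]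
    exact Finset.sum_congr rfl fun _ _ => Finset.sum_congr rfl fun _ _ =>
      Finset.sum_congr rfl fun _ _ => by ring
  rw [e1, h1 fun α => 3 * b α - b α ^ 2 + k ^ 2 - 3 * k, h2 fun α => 3 * b α - b α ^ 2,
    h3 fun α => 3 * b α - b α ^ 2, hbb, hbb', hbb'']
  generalize hXX : (fun α => ∑ σ, U σ * K α σ) = X at *
  have hXX' : ∀ α, ∑ σ, U σ * K α σ = X α := fun α => congrFun hXX α
  simp only [hXX'] at *
  have e2 : ∑ α, (2 - b α - k) * (b α + 1 - k) * (U α * D α)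
      - ∑ α, (k - b α) * (b α + 1 - k) * (U α * D α)
      = 2 * (1 - k) * ∑ α, b α * (U α * D α) + 2 * (1 - k) ^ 2 * ∑ α, U α * D α := by
    simp only [← Finset.sum_add_distrib, Finset.mul_sum, ← Finset.sum_sub_distrib]
    exact Finset.sum_congr rfl fun _ _ => by ring
  have e3 : ∑ α, (3 * b α - b α ^ 2 + k ^ 2 - 3 * k) * X α
      = 3 * ∑ α, b α * X α - ∑ α, b α ^ 2 * X α + (k ^ 2 - 3 * k) * ∑ α, X α := by
    simp only [← Finset.sum_add_distrib, Finset.mul_sum, ← Finset.sum_sub_distrib]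
    exact Finset.sum_congr rfl fun _ _ => by ring
  have e4 : ∑ α, (3 * b α - b α ^ 2) * X α = 3 * ∑ α, b α * X α - ∑ α, b α ^ 2 * X α := by
    simp only [Finset.mul_sum, ← Finset.sum_sub_distrib]
    exact Finset.sum_congr rfl fun _ _ => by ring
  have e5 : ∑ α, (b α * (1 - b α) - k / 6) * X α
      = ∑ α, b α * X α - ∑ α, b α ^ 2 * X α - k / 6 * ∑ α, X α := by
    simp only [Finset.mul_sum, ← Finset.sum_sub_distrib]
    exact Finset.sum_congr rfl fun _ _ => by ring
  rw [e3, e4, e5]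
  linear_combination 2 * e2 + 4 * (1 - k) * hbD + (-24 : ℂ) * hbX
    + (-4 * (k ^ 2 - 3 * k) - 2 * k) * hX

end Tensor

section Getzler

variable {N : ℕ}

theorem sum_perm_fin_four (f : Fin 4 × Fin 4 × Fin 4 × Fin 4 → ℂ) :
    ∑ g : Equiv.Perm (Fin 4), f (g 0, g 1, g 2, g 3)
      = f (0, 1, 2, 3) + f (0, 1, 3, 2) + f (0, 2, 1, 3) + f (0, 2, 3, 1)
      + f (0, 3, 1, 2) + f (0, 3, 2, 1) + f (1, 0, 2, 3) + f (1, 0, 3, 2)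
      + f (1, 2, 0, 3) + f (1, 2, 3, 0) + f (1, 3, 0, 2) + f (1, 3, 2, 0)
      + f (2, 0, 1, 3) + f (2, 0, 3, 1) + f (2, 1, 0, 3) + f (2, 1, 3, 0)
      + f (2, 3, 0, 1) + f (2, 3, 1, 0) + f (3, 0, 1, 2) + f (3, 0, 2, 1)
      + f (3, 1, 0, 2) + f (3, 1, 2, 0) + f (3, 2, 0, 1) + f (3, 2, 1, 0) := by
  have h : (Finset.univ : Finset (Equiv.Perm (Fin 4))).val.map
      (fun g => (g 0, g 1, g 2, g 3)) =
      (([(0, 1, 2, 3), (0, 1, 3, 2), (0, 2, 1, 3), (0, 2, 3, 1), (0, 3, 1, 2), (0, 3, 2, 1),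
        (1, 0, 2, 3), (1, 0, 3, 2), (1, 2, 0, 3), (1, 2, 3, 0), (1, 3, 0, 2), (1, 3, 2, 0),
        (2, 0, 1, 3), (2, 0, 3, 1), (2, 1, 0, 3), (2, 1, 3, 0), (2, 3, 0, 1), (2, 3, 1, 0),
        (3, 0, 1, 2), (3, 0, 2, 1), (3, 1, 0, 2), (3, 1, 2, 0), (3, 2, 0, 1), (3, 2, 1, 0)] :
        List (Fin 4 × Fin 4 × Fin 4 × Fin 4)) : Multiset (Fin 4 × Fin 4 × Fin 4 × Fin 4)) := by
    decide +kernel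
  have h2 := congrArg (fun s => (s.map f).sum) h
  simp only [Multiset.map_map, Multiset.map_coe, Multiset.sum_coe, List.map_cons, List.map_nil,
    List.sum_cons, List.sum_nil] at h2
  refine Eq.trans ?_ (h2.trans (by ring))
  rfl

/-- `G₀` with the permutations of its arguments collected. -/
theorem G0func_eq {F0 : Pt N → ℂ} (hF : ContDiff ℂ (⊤ : ℕ∞) F0)
    {ηinv : Matrix (Fin N) (Fin N) ℂ} (v : Fin 4 → VF N) (t : Pt N)
    (S : VF N → VF N → VF N → VF N → ℂ)
    (hS : ∀ x y z w, S x y z w = ∑ α, corr F0 [x, y, z, dua ηinv α] t *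
        (∑ β, corr F0 [bas α, w, bas β, dua ηinv β] t))
    (A : VF N → VF N → VF N → VF N → ℂ)
    (hA : ∀ x y z w, A x y z w = ∑ α, corr F0 [x, y, z, w, dua ηinv α] t *
        (∑ β, corr F0 [bas α, bas β, dua ηinv β] t))
    (Q : VF N → VF N → VF N → VF N → ℂ)
    (hQ : ∀ x y z w, Q x y z w = ∑ α, ∑ β, corr F0 [x, y, dua ηinv α, dua ηinv β] t *
        corr F0 [bas α, bas β, z, w] t) :
    G0func F0 ηinv v t
      = S (v 1) (v 2) (v 3) (v 0) + S (v 0) (v 2) (v 3) (v 1)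
        + S (v 0) (v 1) (v 3) (v 2) + S (v 0) (v 1) (v 2) (v 3)
        + A (v 0) (v 1) (v 2) (v 3)
        - (Q (v 0) (v 1) (v 2) (v 3) + Q (v 2) (v 3) (v 0) (v 1)
          + Q (v 0) (v 2) (v 1) (v 3) + Q (v 1) (v 3) (v 0) (v 2)
          + Q (v 0) (v 3) (v 1) (v 2) + Q (v 1) (v 2) (v 0) (v 3)) := by
  have S12 : ∀ x y z w, S x y z w = S y x z w := fun x y z w => by
    simp only [hS, corr_perm (List.Perm.swap y x _) hF]
  have S23 : ∀ x y z w, S x y z w = S x z y w := fun x y z w => by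
    simp only [hS, corr_perm ((List.Perm.swap z y _).cons x) hF]
  have A12 : ∀ x y z w, A x y z w = A y x z w := fun x y z w => by
    simp only [hA, corr_perm (List.Perm.swap y x _) hF]
  have A23 : ∀ x y z w, A x y z w = A x z y w := fun x y z w => by
    simp only [hA, corr_perm ((List.Perm.swap z y _).cons x) hF]
  have A34 : ∀ x y z w, A x y z w = A x y w z := fun x y z w => by
    simp only [hA, corr_perm (((List.Perm.swap w z _).cons y).cons x) hF]
  have Q12 : ∀ x y z w, Q x y z w = Q y x z w := fun x y z w => by
    simp only [hQ, corr_perm (List.Perm.swap y x _) hF]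
  have Q34 : ∀ x y z w, Q x y z w = Q x y w z := fun x y z w => by
    simp only [hQ, corr_perm (((List.Perm.swap w z _).cons _).cons _) hF]
  have key := sum_perm_fin_four fun p : Fin 4 × Fin 4 × Fin 4 × Fin 4 =>
    (1/6) * S (v p.1) (v p.2.1) (v p.2.2.1) (v p.2.2.2)
      + (1/24) * A (v p.1) (v p.2.1) (v p.2.2.1) (v p.2.2.2)
      - (1/4) * Q (v p.1) (v p.2.1) (v p.2.2.1) (v p.2.2.2)
  simp only [hS, hA, hQ] at key
  refine key.trans ?_
  simp only [← hS, ← hA, ← hQ]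
  generalize v 0 = a, v 1 = b, v 2 = c, v 3 = d
  simp only [S12, S23, A12, A23, A34, Q12, Q34]
  ring

section Contraction

variable {F0 : Pt N → ℂ} {ηinv : Matrix (Fin N) (Fin N) ℂ}

theorem corr_dua_middle (hF : ContDiff ℂ (⊤ : ℕ∞) F0) (l₁ l₂ : List (VF N)) (α : Fin N)
    (t : Pt N) :
    corr F0 (l₁ ++ dua ηinv α :: l₂) t = ∑ β, ηinv α β * corr F0 (l₁ ++ bas β :: l₂) t := by
  simp only [corr_perm List.perm_middle hF, corr_dua_cons]

/-- Contractions of correlators are unchanged when raised and lowered indices are exchanged. -/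
theorem sum_dua_mul_bas (hη : ∀ α β, ηinv α β = ηinv β α) (hF : ContDiff ℂ (⊤ : ℕ∞) F0)
    (l₁ l₂ m₁ m₂ : List (VF N)) (t : Pt N) :
    ∑ α, corr F0 (l₁ ++ dua ηinv α :: l₂) t * corr F0 (m₁ ++ bas α :: m₂) t
      = ∑ α, corr F0 (l₁ ++ bas α :: l₂) t * corr F0 (m₁ ++ dua ηinv α :: m₂) t := by
  simp only [corr_dua_middle hF, Finset.sum_mul, Finset.mul_sum]
  rw [Finset.sum_comm]
  exact Finset.sum_congr rfl fun _ _ => Finset.sum_congr rfl fun _ _ => by rw [hη]; ring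

theorem sum_rotate {ι : Type*} [Fintype ι] (f : ι → ι → ι → ℂ) :
    ∑ μ, ∑ α, ∑ β, f μ α β = ∑ α, ∑ β, ∑ μ, f μ α β := by
  rw [Finset.sum_comm]
  exact Finset.sum_congr rfl fun _ _ => Finset.sum_comm

/-- `G₀` on a repeated vector field and a contracted dual pair. -/
theorem sum_G0func_dual_pair (hη : ∀ α β, ηinv α β = ηinv β α)
    (hF : ContDiff ℂ (⊤ : ℕ∞) F0) (E : VF N) (t : Pt N) :
    ∑ μ, G0func F0 ηinv ![E, E, dua ηinv μ, bas μ] t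
      = 2 * ∑ μ, ∑ α, corr F0 [E, dua ηinv μ, bas μ, dua ηinv α] t *
          (∑ β, corr F0 [bas α, E, bas β, dua ηinv β] t)
        + ∑ μ, ∑ α, corr F0 [E, E, dua ηinv μ, bas μ, dua ηinv α] t *
          (∑ β, corr F0 [bas α, bas β, dua ηinv β] t)
        - 4 * ∑ μ, ∑ α, ∑ β, corr F0 [E, dua ηinv μ, dua ηinv α, dua ηinv β] t *
          corr F0 [bas α, bas β, E, bas μ] t := by
  set S : VF N → VF N → VF N → VF N → ℂ := fun x y z w =>
    ∑ α, corr F0 [x, y, z, dua ηinv α] t * (∑ β, corr F0 [bas α, w, bas β, dua ηinv β] t)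
    with hS
  set A : VF N → VF N → VF N → VF N → ℂ := fun x y z w =>
    ∑ α, corr F0 [x, y, z, w, dua ηinv α] t * (∑ β, corr F0 [bas α, bas β, dua ηinv β] t)
    with hA
  set Q : VF N → VF N → VF N → VF N → ℂ := fun x y z w =>
    ∑ α, ∑ β, corr F0 [x, y, dua ηinv α, dua ηinv β] t * corr F0 [bas α, bas β, z, w] t
    with hQ
  have hS' : ∑ μ, S E E (bas μ) (dua ηinv μ) = ∑ μ, S E E (dua ηinv μ) (bas μ) := by
    simp only [hS, Finset.mul_sum]
    refine (sum_rotate _).trans (Eq.trans ?_ (sum_rotate _).symm)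
    exact Finset.sum_congr rfl fun α _ => Finset.sum_congr rfl fun β _ =>
      (sum_dua_mul_bas hη hF [E, E] [dua ηinv α] [bas α] [bas β, dua ηinv β] t).symm
  have hSQ : ∑ μ, S E E (dua ηinv μ) (bas μ) = ∑ μ, Q E E (dua ηinv μ) (bas μ) := by
    simp only [hS, hQ, Finset.mul_sum]
    refine Eq.trans ?_ (sum_rotate _).symm
    rw [Finset.sum_comm]
    refine Finset.sum_congr rfl fun α _ => Finset.sum_congr rfl fun μ _ =>
      Finset.sum_congr rfl fun β _ => ?_
    rw [corr_perm (List.Perm.swap (dua ηinv α) (dua ηinv μ) [] |>.cons E |>.cons E) hF,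
      corr_perm (List.Perm.swap (dua ηinv β) (bas β) [] |>.cons (bas μ) |>.cons (bas α)) hF]
  have hQQ : ∑ μ, Q (dua ηinv μ) (bas μ) E E = ∑ μ, Q E E (dua ηinv μ) (bas μ) := by
    simp only [hQ]
    refine Finset.sum_congr rfl fun μ _ => ?_
    calc _ = ∑ β, ∑ α, corr F0 [dua ηinv μ, bas μ, bas α, dua ηinv β] t *
            corr F0 [dua ηinv α, bas β, E, E] t := by
          rw [Finset.sum_comm]
          exact Finset.sum_congr rfl fun β _ => sum_dua_mul_bas hη hF
            [dua ηinv μ, bas μ] [dua ηinv β] [] [bas β, E, E] t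
      _ = ∑ α, ∑ β, corr F0 [dua ηinv μ, bas μ, bas α, bas β] t *
            corr F0 [dua ηinv α, dua ηinv β, E, E] t := by
          rw [Finset.sum_comm]
          exact Finset.sum_congr rfl fun α _ => sum_dua_mul_bas hη hF
            [dua ηinv μ, bas μ, bas α] [] [dua ηinv α] [E, E] t
      _ = _ := by
          refine Finset.sum_congr rfl fun α _ => Finset.sum_congr rfl fun β _ => ?_
          rw [mul_comm]
          exact congrArg₂ (· * ·)
            (corr_perm (List.perm_append_comm (l₁ := [dua ηinv α, dua ηinv β])
              (l₂ := [E, E])) hF t)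
            (corr_perm (List.perm_append_comm (l₁ := [dua ηinv μ, bas μ])
              (l₂ := [bas α, bas β])) hF t)
  have hQ' : ∑ μ, Q E (bas μ) E (dua ηinv μ) = ∑ μ, Q E (dua ηinv μ) E (bas μ) := by
    simp only [hQ]
    refine (sum_rotate _).trans (Eq.trans ?_ (sum_rotate _).symm)
    exact Finset.sum_congr rfl fun α _ => Finset.sum_congr rfl fun β _ =>
      (sum_dua_mul_bas hη hF [E] [dua ηinv α, dua ηinv β] [bas α, bas β, E] [] t).symm
  have key : ∀ μ, G0func F0 ηinv ![E, E, dua ηinv μ, bas μ] t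
      = 2 * S E (dua ηinv μ) (bas μ) E + S E E (bas μ) (dua ηinv μ)
        + S E E (dua ηinv μ) (bas μ) + A E E (dua ηinv μ) (bas μ)
        - Q E E (dua ηinv μ) (bas μ) - Q (dua ηinv μ) (bas μ) E E
        - 2 * Q E (dua ηinv μ) E (bas μ) - 2 * Q E (bas μ) E (dua ηinv μ) := fun μ => by
    rw [G0func_eq hF _ t S (fun _ _ _ _ => rfl) A (fun _ _ _ _ => rfl) Q (fun _ _ _ _ => rfl)]
    simp only [Matrix.cons_val]
    ring
  simp only [key, Finset.sum_add_distrib, Finset.sum_sub_distrib, ← Finset.mul_sum]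
  linear_combination hS' + 2 * hSQ - hQQ - 2 * hQ'

end Contraction

end Getzler

section Main

variable {N : ℕ} {F0 : Pt N → ℂ} {ηinv : Matrix (Fin N) (Fin N) ℂ}

theorem isWeight_dua {b : Fin N → ℂ} (hb : ∀ α β, ηinv α β ≠ 0 → b α + b β = 1) (α : Fin N) :
    IsWeight b (ηinv α) (1 - b α) := fun β h => by linear_combination hb α β h

/-- Associativity of the quantum product in terms of the third partial derivatives. -/
theorem wdvv_contraction {ηm : Matrix (Fin N) (Fin N) ℂ} (hη2 : ηm * ηinv = 1)
    (hwdvv : ∀ u v w : VF N,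
      qp F0 ηinv (qp F0 ηinv u v) w = qp F0 ηinv u (qp F0 ηinv v w))
    (t : Pt N) (x y z w : Fin N) :
    ∑ σ, ∑ ρ, ηinv σ ρ * (pd ρ (pd y (pd x F0)) t * pd w (pd z (pd σ F0)) t)
      = ∑ σ, ∑ ρ, ηinv σ ρ * (pd ρ (pd z (pd y F0)) t * pd w (pd σ (pd x F0)) t) := by
  have hs : ∀ f : Fin N → ℂ, ∑ τ, ηm w τ * ∑ ρ, ηinv τ ρ * f ρ = f w := fun f => by
    simp only [Finset.mul_sum]
    rw [Finset.sum_comm]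
    simp only [← mul_assoc, ← Finset.sum_mul]
    have : ∀ ρ, ∑ τ, ηm w τ * ηinv τ ρ = (1 : Matrix (Fin N) (Fin N) ℂ) w ρ := fun ρ => by
      rw [← hη2, Matrix.mul_apply]
    simp [this, Matrix.one_apply]
  have h1 := fun τ => congrFun (congrFun (hwdvv (bas x) (bas y) (bas z)) t) τ
  have h2 := Finset.sum_congr (rfl : (univ : Finset (Fin N)) = univ) fun τ _ =>
    congrArg (ηm w τ * ·) (h1 τ)
  have hL : ∀ τ, qp F0 ηinv (qp F0 ηinv (bas x) (bas y)) (bas z) t τ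
      = ∑ ρ, ηinv τ ρ * ∑ σ, (∑ ρ', ηinv σ ρ' * pd ρ' (pd y (pd x F0)) t)
        * pd ρ (pd z (pd σ F0)) t := fun τ => by
    rw [qp, corr_cons]
    simp only [qp, corr_bas_cons, corr_dua_cons, corr_nil, Finset.mul_sum]
    rw [Finset.sum_comm]
    exact Finset.sum_congr rfl fun _ _ => Finset.sum_congr rfl fun _ _ => by ring
  have hR : ∀ τ, qp F0 ηinv (bas x) (qp F0 ηinv (bas y) (bas z)) t τ
      = ∑ ρ, ηinv τ ρ * ∑ σ, (∑ ρ', ηinv σ ρ' * pd ρ' (pd z (pd y F0)) t)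
        * pd ρ (pd σ (pd x F0)) t := fun τ => by
    rw [qp, corr_bas_cons, corr_cons]
    simp only [qp, corr_bas_cons, corr_dua_cons, corr_nil, Finset.mul_sum]
    rw [Finset.sum_comm]
    exact Finset.sum_congr rfl fun _ _ => Finset.sum_congr rfl fun _ _ => by ring
  simp only [hL, hR, hs] at h2
  simpa only [Finset.sum_mul, mul_assoc] using h2

theorem dirD_corr_euler_euler (hF : ContDiff ℂ (⊤ : ℕ∞) F0) (X : VF N) (c : Pt N)
    (b : Fin N → ℂ) (b1 : ℂ) (x y t : Pt N) :
    dirD X (corr F0 [euler c b b1, euler c b b1, cvf x, cvf y]) t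
      = 2 * corr F0 [nablaVF X (euler c b b1), euler c b b1, cvf x, cvf y] t
        + corr F0 [X, euler c b b1, euler c b b1, cvf x, cvf y] t := by
  set E := euler c b b1 with hE
  have dE : Differentiable ℂ E := differentiable_euler c b b1
  have dx : ∀ x : Pt N, Differentiable ℂ (cvf x) := fun x => differentiable_const x
  have hcc := fun α β => dirD_corr_cvf X t [x, y] (contDiff_pd (contDiff_pd hF α) β)
  simp only [List.map_cons, List.map_nil] at hcc
  have e1 : ∑ α, E t α * corr (pd α F0) [nablaVF X E, cvf x, cvf y] t
      = corr F0 [nablaVF X E, E, cvf x, cvf y] t := by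
    rw [corr_perm (List.Perm.swap E (nablaVF X E) _) hF, corr_cons]
  have e2 : ∑ α, E t α * ∑ β, E t β * corr (pd β (pd α F0)) [X, cvf x, cvf y] t
      = corr F0 [X, E, E, cvf x, cvf y] t := by
    exact corr_perm ((List.perm_append_comm (l₁ := [E, E]) (l₂ := [X])).append_right
      [cvf x, cvf y]) hF t
  rw [dirD_corr_cons hF X E dE (by simp [dE, dx])]
  simp only [dirD_corr_cons (contDiff_pd hF _) X E dE (l := [cvf x, cvf y]) (by simp [dx]), hcc,
    mul_add, Finset.sum_add_distrib]
  rw [e1, e2]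
  ring

end Main

/-- Genus-0 tensor evaluated on two Euler fields and a dual-basis pair:
`Σ_α G₀(E, E, γ^α, γ_α) = −24 · ΔΦ`, where
`Φ = −(1/24)Σ_α ⟨⟨E E γ_α γ^α⟩⟩₀ + (1/2)Σ_α (b_α(1−b_α) − (b₁+1)/6)⟨⟨γ_α γ^α⟩⟩₀`. -/
theorem G0_euler_euler_dual_pair
    {N : ℕ} [NeZero N]
    (ηm ηinv : Matrix (Fin N) (Fin N) ℂ)
    (hηsym : ηm.IsSymm)
    (hη1 : ηm * ηinv = 1) (hη2 : ηinv * ηm = 1)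
    (b : Fin N → ℂ)
    (hb : ∀ α β, ηinv α β ≠ 0 → b α + b β = 1)
    (c : Pt N) (C : Matrix (Fin N) (Fin N) ℂ) (hC : C.IsSymm)
    (F0 : Pt N → ℂ)
    (hF0 : ∀ t, AnalyticAt ℂ F0 t)
    (hid : ∀ v : VF N, qp F0 ηinv (bas 0) v = v)
    (hwdvv : ∀ u v w : VF N,
      qp F0 ηinv (qp F0 ηinv u v) w = qp F0 ηinv u (qp F0 ηinv v w))
    (hqh0 : ∀ t, fderiv ℂ F0 t (euler c b (b 0) t)
      = 2 * (b 0 + 1) * F0 t + (1/2) * ∑ α, ∑ β, C α β * t α * t β) :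
    ∀ t : Pt N,
      ∑ α, G0func F0 ηinv
          ![euler c b (b 0), euler c b (b 0), dua ηinv α, bas α] t
        = -24 * dirD (qvol F0 ηinv)
            (fun s =>
              -(1/24) * ∑ α, corr F0
                  [euler c b (b 0), euler c b (b 0), bas α, dua ηinv α] s
              + (1/2) * ∑ α, (b α * (1 - b α) - (b 0 + 1) / 6) *
                  corr F0 [bas α, dua ηinv α] s) t := by
  intro t
  have hF : ContDiff ℂ (⊤ : ℕ∞) F0 := contDiff_iff_contDiffAt.2 fun t => (hF0 t).contDiffAt
  have hη : ∀ α β, ηinv α β = ηinv β α := fun α β => by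
    have : ηinv.transpose = ηinv := by
      calc ηinv.transpose = ηinv.transpose * (ηm * ηinv) := by rw [hη1, mul_one]
        _ = (ηm * ηinv).transpose * ηinv := by
          rw [Matrix.transpose_mul, hηsym.eq, mul_assoc]
        _ = ηinv := by rw [hη1, Matrix.transpose_one, one_mul]
    exact (congrFun (congrFun this β) α)
  set E := euler c b (b 0) with hE
  set k := b 0 + 1 with hk
  set T : Fin N → Fin N → Fin N → ℂ := fun α β γ => pd γ (pd β (pd α F0)) t with hTdef
  have h12 : ∀ α β γ, T α β γ = T β α γ := fun α β γ => by
    simp only [hTdef]; rw [pd_comm hF β α]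
  have h23 : ∀ α β γ, T α β γ = T α γ β := fun α β γ => by
    simp only [hTdef]; rw [pd_comm (contDiff_pd hF α) γ β]
  have hT : ∀ x y z w, ∑ σ, ∑ ρ, ηinv σ ρ * (T x y σ * T z w ρ)
      = ∑ σ, ∑ ρ, ηinv σ ρ * (T x z σ * T y w ρ) := fun x y z w => by
    rw [Finset.sum_comm, Finset.sum_comm (f := fun σ ρ => ηinv σ ρ * (T x z σ * T y w ρ))]
    have h : ∀ σ ρ, ηinv σ ρ * (T y x ρ * T σ z w) = ηinv ρ σ * (T x y ρ * T z w σ) :=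
      fun σ ρ => by rw [hη, h12 y x, h12 σ z, h23 z σ]
    have h' : ∀ σ ρ, ηinv σ ρ * (T x z ρ * T y σ w) = ηinv ρ σ * (T x z ρ * T y w σ) :=
      fun σ ρ => by rw [hη, h23 y σ]
    simp only [← h, ← h']
    exact wdvv_contraction hη1 hwdvv t y x z w
  set K : Fin N → Fin N → ℂ := fun α γ => ∑ β, ηinv α β * T α β γ with hK
  set D : Fin N → ℂ := fun γ => ∑ α, K α γ with hD
  set U : Fin N → ℂ := fun α => ∑ β, ηinv α β * D β with hU
  set P : Fin N → Fin N → Fin N → ℂ := fun α β γ => ∑ α', ∑ β', ∑ γ',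
    ηinv α α' * ηinv β β' * ηinv γ γ' * T α' β' γ' with hP
  have key := weighted_contraction_identity hη hb k T h12 h23 hT K (fun _ _ => rfl) D U
    (fun _ => rfl) (fun _ => rfl) P (fun _ _ _ => rfl)
  have hKc : ∀ σ β, corr F0 [bas σ, bas β, dua ηinv β] t = K β σ := fun σ β => by
    simp only [corr_bas_cons, corr_dua_cons, corr_nil, hK]
    refine Finset.sum_congr rfl fun γ _ => congrArg (ηinv β γ * ·) ?_
    exact (h12 σ β γ).trans (h23 β σ γ)
  have hDc : ∀ σ, ∑ β, corr F0 [bas σ, bas β, dua ηinv β] t = D σ := fun σ => by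
    simp only [hKc, hD]
  have hUc : ∀ σ, ∑ μ, corr F0 [dua ηinv μ, bas μ, dua ηinv σ] t = U σ := fun σ => by
    simp only [hU, ← hDc, Finset.mul_sum]
    rw [Finset.sum_comm]
    refine Finset.sum_congr rfl fun μ _ => ?_
    refine (corr_perm (List.perm_append_comm (l₁ := [dua ηinv μ, bas μ])
      (l₂ := [dua ηinv σ])) hF t).trans ?_
    refine (corr_dua_cons F0 ηinv σ [dua ηinv μ, bas μ] t).trans ?_
    exact Finset.sum_congr rfl fun β _ => congrArg (ηinv σ β * ·)
      (corr_perm ((List.Perm.swap (bas μ) (dua ηinv μ) []).cons (bas β)) hF t)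
  have hΔ : ∀ σ, qvol F0 ηinv t σ = U σ := fun σ => by
    rw [← hUc, qvol, Finset.sum_apply]; rfl
  have hw : ∀ {x y z : Pt N} {p q r : ℂ}, IsWeight b x p → IsWeight b y q → IsWeight b z r →
      corr F0 [E, cvf x, cvf y, cvf z] t = (p + q + r - k) * corr F0 [cvf x, cvf y, cvf z] t :=
    fun hx hy hz => corr_euler_cvf hF hqh0 hx hy hz t
  have wd := isWeight_dua hb
  have wb := isWeight_single b
  have hDE : ∀ α, ∑ β, corr F0 [bas α, E, bas β, dua ηinv β] t = (b α + 1 - k) * D α :=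
    fun α => by
    rw [← hDc, Finset.mul_sum]
    refine Finset.sum_congr rfl fun β _ => ?_
    rw [corr_perm (List.Perm.swap E (bas α) _) hF]
    exact (hw (wb α) (wb β) (wd β)).trans (congrArg (· * _) (by ring))
  have hUE : ∀ α, ∑ μ, corr F0 [E, dua ηinv μ, bas μ, dua ηinv α] t = (2 - b α - k) * U α :=
    fun α => by
    rw [← hUc, Finset.mul_sum]
    exact Finset.sum_congr rfl fun μ _ =>
      (hw (wd μ) (wb μ) (wd α)).trans (congrArg (· * _) (by ring))
  have l1 : ∑ μ, ∑ α, corr F0 [E, dua ηinv μ, bas μ, dua ηinv α] t *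
      (∑ β, corr F0 [bas α, E, bas β, dua ηinv β] t)
      = ∑ α, (2 - b α - k) * (b α + 1 - k) * (U α * D α) := by
    rw [Finset.sum_comm]
    simp only [← Finset.sum_mul, hDE, hUE]
    exact Finset.sum_congr rfl fun _ _ => by ring
  have l2 : ∑ μ, ∑ α, corr F0 [E, E, dua ηinv μ, bas μ, dua ηinv α] t *
      (∑ β, corr F0 [bas α, bas β, dua ηinv β] t)
      = ∑ α, corr F0 [qvol F0 ηinv, E, E, bas α, dua ηinv α] t := by
    refine Finset.sum_congr rfl fun μ _ => ?_
    have hsw : ∀ α, corr F0 [E, E, dua ηinv μ, bas μ, dua ηinv α] t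
        = ∑ β, ηinv α β * corr (pd β F0) [E, E, bas μ, dua ηinv μ] t := fun α => by
      refine (corr_perm (List.perm_append_comm (l₁ := [E, E, dua ηinv μ, bas μ])
        (l₂ := [dua ηinv α])) hF t).trans ?_
      refine (corr_dua_cons F0 ηinv α [E, E, dua ηinv μ, bas μ] t).trans ?_
      exact Finset.sum_congr rfl fun β _ => congrArg (ηinv α β * ·)
        ((corr_bas_cons F0 β _ t).trans (corr_perm
          (((List.Perm.swap (bas μ) (dua ηinv μ) []).cons E).cons E) (contDiff_pd hF β) t))
    simp only [hsw, hDc, corr_cons F0 (qvol F0 ηinv), hΔ, hU, Finset.sum_mul]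
    rw [Finset.sum_comm]
    refine Finset.sum_congr rfl fun α _ => Finset.sum_congr rfl fun β _ => ?_
    rw [hη]; ring
  have l3 : ∑ μ, ∑ α, ∑ β, corr F0 [E, dua ηinv μ, dua ηinv α, dua ηinv β] t *
      corr F0 [bas α, bas β, E, bas μ] t
      = ∑ α, ∑ β, ∑ γ, (b α + b β + b γ - k) * (3 - b α - b β - b γ - k)
          * (T α β γ * P α β γ) := by
    refine Finset.sum_congr rfl fun μ _ => Finset.sum_congr rfl fun α _ =>
      Finset.sum_congr rfl fun β _ => ?_
    have a1 : corr F0 [E, dua ηinv μ, dua ηinv α, dua ηinv β] t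
        = (3 - b μ - b α - b β - k) * P μ α β := by
      refine (hw (wd μ) (wd α) (wd β)).trans (congrArg₂ (· * ·) (by ring) ?_)
      change corr F0 [dua ηinv μ, dua ηinv α, dua ηinv β] t = _
      simp only [corr_dua_cons, corr_bas_cons, corr_nil, hP, Finset.mul_sum, mul_assoc, hTdef]
    have a2 : corr F0 [bas α, bas β, E, bas μ] t = (b μ + b α + b β - k) * T μ α β := by
      refine (corr_perm (List.perm_append_comm (l₁ := [bas α, bas β])
        (l₂ := [E, bas μ])) hF t).trans ?_
      refine (hw (wb μ) (wb α) (wb β)).trans (congrArg₂ (· * ·) rfl ?_)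
      change corr F0 [bas μ, bas α, bas β] t = _
      simp only [corr_bas_cons, corr_nil, hTdef]
    rw [a1, a2]; ring
  have r1 : ∑ α, corr F0 [nablaVF (qvol F0 ηinv) E, E, bas α, dua ηinv α] t
      = ∑ σ, (k - b σ) * (b σ + 1 - k) * (U σ * D σ) := by
    simp only [corr_cons _ (nablaVF _ _), ← corr_bas_cons]
    rw [Finset.sum_comm]
    simp only [← Finset.mul_sum, hDE]
    refine Finset.sum_congr rfl fun σ _ => ?_
    rw [hE, nablaVF_euler, hΔ]; ring
  have r2 : ∀ α, dirD (qvol F0 ηinv) (corr F0 [bas α, dua ηinv α]) t = ∑ σ, U σ * K α σ :=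
    fun α => by
    refine (dirD_corr_cvf (qvol F0 ηinv) t [Pi.single α 1, ηinv α] hF).trans ?_
    rw [List.map_cons, List.map_cons, List.map_nil, corr_cons]
    refine Finset.sum_congr rfl fun σ _ => ?_
    rw [hΔ, ← hKc, corr_bas_cons]; rfl
  have r3 : ∀ α, dirD (qvol F0 ηinv) (corr F0 [E, E, bas α, dua ηinv α]) t
      = 2 * corr F0 [nablaVF (qvol F0 ηinv) E, E, bas α, dua ηinv α] t
        + corr F0 [qvol F0 ηinv, E, E, bas α, dua ηinv α] t := fun α =>
    dirD_corr_euler_euler hF (qvol F0 ηinv) c b (b 0) (Pi.single α 1) (ηinv α) t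
  have dc : ∀ x : Pt N, Differentiable ℂ (cvf x) := fun x => differentiable_const x
  have d1 : ∀ α, Differentiable ℂ (corr F0 [E, E, bas α, dua ηinv α]) := fun α =>
    corr_differentiable (by simp [hE, differentiable_euler, bas, dua, dc]) hF
  have d2 : ∀ α, Differentiable ℂ (corr F0 [bas α, dua ηinv α]) := fun α =>
    corr_differentiable (by simp [bas, dua, dc]) hF
  have hΦ : dirD (qvol F0 ηinv) (fun s => -(1/24) * ∑ α, corr F0 [E, E, bas α, dua ηinv α] s
        + (1/2) * ∑ α, (b α * (1 - b α) - k / 6) * corr F0 [bas α, dua ηinv α] s) t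
      = -(1/24) * ∑ α, dirD (qvol F0 ηinv) (corr F0 [E, E, bas α, dua ηinv α]) t
        + (1/2) * ∑ α, (b α * (1 - b α) - k / 6)
          * dirD (qvol F0 ηinv) (corr F0 [bas α, dua ηinv α]) t := by
    have := ((HasFDerivAt.fun_sum (u := univ) fun α _ => (d1 α t).hasFDerivAt).const_mul
      (-(1/24 : ℂ))).add ((HasFDerivAt.fun_sum (u := univ) fun α _ =>
        (d2 α t).hasFDerivAt.const_mul (b α * (1 - b α) - k / 6)).const_mul (1/2 : ℂ))
    refine (DFunLike.congr_fun this.fderiv _).trans ?_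
    simp only [smul_apply, add_apply, _root_.sum_apply, smul_eq_mul, dirD]
  rw [hΦ, sum_G0func_dual_pair hη hF, l1, l2, l3]
  simp only [r2, r3, Finset.sum_add_distrib, ← Finset.mul_sum, r1]
  linear_combination key
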